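/- Let κ ≥ 0, let H be a real symmetric positive definite n×n matrix, and let L be a real n×n matrix with vᵀ H L v ≤ −κ vᵀ H v for every v ∈ ℝⁿ (interior H-dissipativity). Let w : ℝ → ℝ be nonnegative and locally integrable, let 0 < t_1 < ⋯ < t_m ≤ T be finitely many atoms, and let J_1, …, J_m be real n×n matrices with J_kᵀ H J_k ≼ ρ_k H for some ρ_k ∈ (0,1]. Suppose u : [0,T] → ℝⁿ is right-continuous, has left limits u(t_k⁻) at the atoms, is locally absolutely continuous on each interval between consecutive atoms with u′(τ) = w(τ) · L u(τ) for almost every τ there, and satisfies u(t_k) = J_k u(t_k⁻) at every atom. Then the discrete energy E_h(v) := (1/2) vᵀ H v satisfies, for all 0 ≤ s ≤ t ≤ T, E_h(u(t)) ≤ exp(−2 κ ∫_s^t w(τ) dτ) · (∏_{t_k ∈ (s,t]} ρ_k) · E_h(u(s)). -/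

import Mathlib

open MeasureTheory Filter Set Matrix

/-- Postcomposition with a function that is Lipschitz on the image preserves absolute continuity. -/
theorem LipschitzOnWith.comp_absolutelyContinuousOnInterval {X Y : Type*} [PseudoMetricSpace X]
    [PseudoMetricSpace Y] {K : NNReal} {g : X → Y} {f : ℝ → X} {a b : ℝ}
    (hg : LipschitzOnWith K g (f '' uIcc a b)) (hf : AbsolutelyContinuousOnInterval f a b) :
    AbsolutelyContinuousOnInterval (fun y => g (f y)) a b := by
  refine squeeze_zero' (Eventually.of_forall fun _ => Finset.sum_nonneg fun _ _ => dist_nonneg) ?_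
    (by simpa using Tendsto.const_mul (K : ℝ) hf)
  rw [eventually_inf_principal]
  refine Eventually.of_forall fun E hE => ?_
  rw [Finset.mul_sum]
  refine Finset.sum_le_sum fun i hi => hg.dist_le_mul _ ?_ _ ?_
  · exact mem_image_of_mem f (hE.1 i hi).1
  · exact mem_image_of_mem f (hE.1 i hi).2

theorem AbsolutelyContinuousOnInterval.congr {X : Type*} [PseudoMetricSpace X] {f g : ℝ → X}
    {a b : ℝ} (hf : AbsolutelyContinuousOnInterval f a b) (hfg : EqOn f g (uIcc a b)) :
    AbsolutelyContinuousOnInterval g a b := by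
  refine Tendsto.congr' ?_ hf
  refine eventually_inf_principal.2 (Eventually.of_forall fun E hE => ?_)
  refine Finset.sum_congr rfl fun i hi => ?_
  rw [hfg (hE.1 i hi).1, hfg (hE.1 i hi).2]

theorem AbsolutelyContinuousOnInterval.real_exp {f : ℝ → ℝ} {a b : ℝ}
    (hf : AbsolutelyContinuousOnInterval f a b) :
    AbsolutelyContinuousOnInterval (fun y => Real.exp (f y)) a b := by
  obtain ⟨C, hC⟩ := hf.exists_bound
  have hsub : f '' uIcc a b ⊆ Icc (-C) C := by
    rintro _ ⟨y, hy, rfl⟩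
    exact abs_le.mp (hC y hy)
  obtain ⟨K, hK⟩ := (Real.contDiff_exp (n := 1)).contDiffOn.exists_lipschitzOnWith
    one_ne_zero (convex_Icc (-C) C) isCompact_Icc
  exact (hK.mono hsub).comp_absolutelyContinuousOnInterval hf

theorem AbsolutelyContinuousOnInterval.finset_sum {ι : Type*} (S : Finset ι) {f : ι → ℝ → ℝ}
    {a b : ℝ} (hf : ∀ i ∈ S, AbsolutelyContinuousOnInterval (f i) a b) :
    AbsolutelyContinuousOnInterval (fun y => ∑ i ∈ S, f i y) a b := by
  classical
  induction S using Finset.induction_on with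
  | empty =>
    simpa using (LipschitzWith.const (0 : ℝ)).lipschitzOnWith.absolutelyContinuousOnInterval
  | insert i S hi ih =>
    simp only [Finset.sum_insert hi]
    exact (hf i (by simp)).fun_add (ih fun j hj => hf j (by simp [hj]))

/-- An absolutely continuous function with almost everywhere nonpositive derivative decreases. -/
theorem AbsolutelyContinuousOnInterval.le_of_ae_hasDerivAt_nonpos {g g' : ℝ → ℝ} {p q : ℝ}
    (hpq : p ≤ q) (hg : AbsolutelyContinuousOnInterval g p q)
    (hd : ∀ᵐ y, y ∈ Ioo p q → HasDerivAt g (g' y) y ∧ g' y ≤ 0) : g q ≤ g p := by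
  have h0 : 0 ≤ ∫ y in p..q, -deriv g y := by
    refine intervalIntegral.integral_nonneg_of_ae_restrict hpq ?_
    rw [← restrict_Ioo_eq_restrict_Icc]
    refine (ae_restrict_iff' measurableSet_Ioo).2 ?_
    filter_upwards [hd] with y hy hmem
    obtain ⟨h1, h2⟩ := hy hmem
    simpa [h1.deriv] using h2
  rw [intervalIntegral.integral_neg, hg.integral_deriv_eq_sub] at h0
  linarith

theorem Matrix.IsSymm.dotProduct_mulVec_comm {ι : Type*} [Fintype ι] {H : Matrix ι ι ℝ}
    (hH : H.IsSymm) (a b : ι → ℝ) : a ⬝ᵥ H *ᵥ b = b ⬝ᵥ H *ᵥ a := by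
  rw [dotProduct_mulVec, ← mulVec_transpose, hH.eq, dotProduct_comm]

theorem Matrix.IsSymm.hasDerivAt_quadraticForm {ι : Type*} [Fintype ι] {H : Matrix ι ι ℝ}
    (hH : H.IsSymm) {v : ℝ → ι → ℝ} {v' : ι → ℝ} {y : ℝ} (hv : HasDerivAt v v' y) :
    HasDerivAt (fun z => v z ⬝ᵥ H *ᵥ v z) (2 * (v y ⬝ᵥ H *ᵥ v')) y := by
  have hc := hasDerivAt_pi.1 hv
  have h := HasDerivAt.fun_sum (u := Finset.univ) fun i _ =>
    (hc i).fun_mul (HasDerivAt.fun_sum (u := Finset.univ) fun j _ => (hc j).const_mul (H i j))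
  refine h.congr_deriv ?_
  rw [Finset.sum_add_distrib]
  change v' ⬝ᵥ H *ᵥ v y + v y ⬝ᵥ H *ᵥ v' = _
  rw [hH.dotProduct_mulVec_comm v' (v y)]
  ring

/-- Energy decay for the integrated equation `v' = w • L v` on an interval without atoms. -/
theorem quadraticForm_le_exp_mul_of_dissipative {ι : Type*} [Fintype ι] {H L : Matrix ι ι ℝ}
    (hH : H.IsSymm) {κ : ℝ} (hL : ∀ v : ι → ℝ, v ⬝ᵥ H *ᵥ (L *ᵥ v) ≤ -κ * (v ⬝ᵥ H *ᵥ v))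
    {w : ℝ → ℝ} (hw_nonneg : ∀ τ, 0 ≤ w τ) {p q : ℝ} (hpq : p ≤ q)
    (hw : IntervalIntegrable w volume p q) {v f : ℝ → ι → ℝ}
    (hf : IntervalIntegrable f volume p q) (hfv : ∀ y ∈ Ioo p q, f y = w y • L *ᵥ v y)
    (hv : ∀ y ∈ Icc p q, v y = v p + ∫ τ in p..y, f τ) :
    v q ⬝ᵥ H *ᵥ v q ≤ Real.exp (-(2 * κ) * ∫ τ in p..q, w τ) * (v p ⬝ᵥ H *ᵥ v p) := by
  set V : ℝ → ι → ℝ := fun y => v p + ∫ τ in p..y, f τ with hV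
  set W : ℝ → ℝ := fun y => 2 * κ * ∫ τ in p..y, w τ with hW
  have hfi (i : ι) : IntervalIntegrable (fun τ => f τ i) volume p q := by
    rw [intervalIntegrable_iff] at hf ⊢
    exact hf.eval i
  have hVac (i : ι) : AbsolutelyContinuousOnInterval (fun y => V y i) p q := by
    have h1 : AbsolutelyContinuousOnInterval (fun y => v p i + ∫ τ in p..y, f τ i) p q :=
      ((LipschitzWith.const (v p i)).lipschitzOnWith.absolutelyContinuousOnInterval).fun_add
        ((hfi i).absolutelyContinuousOnInterval_intervalIntegral left_mem_uIcc)
    refine h1.congr fun y hy => ?_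
    have hfy : IntervalIntegrable f volume p y := hf.mono_set (uIcc_subset_uIcc_left hy)
    exact congrArg (v p i + ·)
      ((ContinuousLinearMap.proj (R := ℝ) (φ := fun _ : ι => ℝ) i).intervalIntegral_comp_comm hfy)
  have hWac : AbsolutelyContinuousOnInterval (fun y => Real.exp (W y)) p q :=
    ((hw.absolutelyContinuousOnInterval_intervalIntegral left_mem_uIcc).const_mul _).real_exp
  have hQac : AbsolutelyContinuousOnInterval (fun y => V y ⬝ᵥ H *ᵥ V y) p q :=
    .finset_sum _ fun i _ => (hVac i).fun_mul (.finset_sum _ fun j _ => (hVac j).const_mul _)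
  have key := (hWac.fun_mul hQac).le_of_ae_hasDerivAt_nonpos hpq
    (g' := fun y => Real.exp (W y) * (2 * κ * w y) * (V y ⬝ᵥ H *ᵥ V y) +
      Real.exp (W y) * (2 * (V y ⬝ᵥ H *ᵥ f y))) (by
    filter_upwards [hw.ae_hasDerivAt_integral, hf.ae_hasDerivAt_integral] with y hyw hyf hy
    have hmem : y ∈ uIcc p q := by rw [uIcc_of_le hpq]; exact Ioo_subset_Icc_self hy
    have hdV : HasDerivAt V (f y) y := (hyf hmem p left_mem_uIcc).const_add (v p)
    refine ⟨(((hyw hmem p left_mem_uIcc).const_mul (2 * κ)).exp).fun_mul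
      (hH.hasDerivAt_quadraticForm hdV), ?_⟩
    have hVy : v y = V y := hv y (Ioo_subset_Icc_self hy)
    rw [hfv y hy, hVy, mulVec_smul, dotProduct_smul, smul_eq_mul]
    have h := mul_nonpos_of_nonneg_of_nonpos
      (mul_nonneg (Real.exp_pos (W y)).le (hw_nonneg y)) (sub_nonpos.2 (hL (V y)))
    linarith)
  have hVp : V p = v p := by simp [hV]
  have hVq : V q = v q := (hv q (right_mem_Icc.2 hpq)).symm
  have hWp : W p = 0 := by simp [hW]
  simp only [hVp, hVq, hWp, Real.exp_zero, one_mul] at key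
  rw [neg_mul, Real.exp_neg, inv_mul_eq_div, le_div_iff₀ (Real.exp_pos _), mul_comm]
  exact key

theorem Matrix.PosSemidef.quadraticForm_mulVec_le {ι : Type*} [Fintype ι] {H J : Matrix ι ι ℝ}
    {ρ : ℝ} (hJ : (ρ • H - J.transpose * H * J).PosSemidef) (v : ι → ℝ) :
    (J *ᵥ v) ⬝ᵥ H *ᵥ (J *ᵥ v) ≤ ρ * (v ⬝ᵥ H *ᵥ v) := by
  have h := hJ.dotProduct_mulVec_nonneg v
  rw [star_trivial, sub_mulVec, dotProduct_sub, smul_mulVec, dotProduct_smul, ← mulVec_mulVec,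
    ← mulVec_mulVec, dotProduct_mulVec v J.transpose, vecMul_transpose, smul_eq_mul] at h
  linarith

/-- **Semi-discrete energy decay in σ-time.**
`H` is symmetric positive definite, the interior operator `L` is `H`-dissipative
(`vᵀ H L v ≤ -κ vᵀ H v`), `w ≥ 0` is the locally integrable clock density, the
atoms `0 < t 0 < ⋯ < t (m-1) ≤ T` carry update matrices `J k` with
`J kᵀ H (J k) ≼ ρ k • H` for `ρ k ∈ (0,1]`. If `u` is right-continuous, has left
limits `uminus k` at the atoms, solves `u' = w · L u` between consecutive atoms
(in integrated form), and satisfies `u (t k) = J k (uminus k)` at every atom, then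
the discrete energy `E_h v = (1/2) vᵀ H v` satisfies, for all `0 ≤ s ≤ x ≤ T`,
`E_h (u x) ≤ exp(-2κ ∫_s^x w) · (∏_{t k ∈ (s,x]} ρ k) · E_h (u s)`. -/
theorem semidiscrete_sigma_energy_decay
    (κ T : ℝ) (hκ : 0 ≤ κ) (hT : 0 < T)
    (d : ℕ) (H L : Matrix (Fin d) (Fin d) ℝ)
    (hH_symm : H.IsSymm) (hH_pd : H.PosDef)
    (hL : ∀ v : Fin d → ℝ, v ⬝ᵥ H.mulVec (L.mulVec v) ≤ -κ * (v ⬝ᵥ H.mulVec v))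
    (w : ℝ → ℝ) (hw_nonneg : ∀ τ, 0 ≤ w τ) (hw_loc : LocallyIntegrable w volume)
    (m : ℕ) (t : Fin m → ℝ)
    (ht_mono : StrictMono t) (ht_pos : ∀ k, 0 < t k) (ht_le : ∀ k, t k ≤ T)
    (J : Fin m → Matrix (Fin d) (Fin d) ℝ) (ρ : Fin m → ℝ)
    (hρ : ∀ k, ρ k ∈ Ioc (0:ℝ) 1)
    (hJ : ∀ k, (ρ k • H - (J k).transpose * H * (J k)).PosSemidef)
    (u : ℝ → Fin d → ℝ) (uminus : Fin m → Fin d → ℝ)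
    (hu_rc : ∀ x ∈ Ico (0:ℝ) T, ContinuousWithinAt u (Ici x) x)
    (hu_left : ∀ k, Tendsto u (nhdsWithin (t k) (Iio (t k))) (nhds (uminus k)))
    (hint : IntegrableOn (fun τ => w τ • L.mulVec (u τ)) (Icc (0:ℝ) T) volume)
    (hODE : ∀ p q : ℝ, 0 ≤ p → p ≤ q → q ≤ T → (∀ k, t k ∉ Ioc p q) →
      u q - u p = ∫ τ in p..q, w τ • L.mulVec (u τ))
    (hjump : ∀ k, u (t k) = (J k).mulVec (uminus k)) :
    ∀ s x : ℝ, 0 ≤ s → s ≤ x → x ≤ T →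
      (1/2) * (u x ⬝ᵥ H.mulVec (u x)) ≤
        Real.exp (-(2 * κ) * ∫ τ in s..x, w τ) *
          (∏ k : Fin m, (if t k ∈ Ioc s x then ρ k else 1)) *
          ((1/2) * (u s ⬝ᵥ H.mulVec (u s))) := by
  have hw_ii (p q : ℝ) : IntervalIntegrable w volume p q := 
    (hw_loc.integrableOn_isCompact isCompact_uIcc).intervalIntegrable
  have hf_ii {p q : ℝ} (hp : 0 ≤ p) (hpq : p ≤ q) (hq : q ≤ T) :
      IntervalIntegrable (fun τ => w τ • L *ᵥ u τ) volume p q :=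
    (hint.mono_set (by rw [uIcc_of_le hpq]; exact Icc_subset_Icc hp hq)).intervalIntegrable
  have hu_int {p q : ℝ} (hp : 0 ≤ p) (hpq : p ≤ q) (hq : q ≤ T) (hno : ∀ k, t k ∉ Ioc p q) :
      u q = u p + ∫ τ in p..q, w τ • L *ᵥ u τ := by
    rw [← hODE p q hp hpq hq hno]; abel
  have hquad (v : Fin d → ℝ) : 0 ≤ v ⬝ᵥ H *ᵥ v := by
    simpa using hH_pd.posSemidef.dotProduct_mulVec_nonneg v
  -- Up to the next atom, the flow reaches the left limit.
  have hleft (s : ℝ) (k : Fin m) (hs : 0 ≤ s) (hsk : s < t k) (hno : ∀ j, t j ∉ Ioo s (t k)) :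
      uminus k ⬝ᵥ H *ᵥ uminus k ≤
        Real.exp (-(2 * κ) * ∫ τ in s..t k, w τ) * (u s ⬝ᵥ H *ᵥ u s) := by
    have hseg (y : ℝ) (hy : y ∈ Ico s (t k)) : u y = u s + ∫ τ in s..y, w τ • L *ᵥ u τ :=
      hu_int hs hy.1 (hy.2.le.trans (ht_le k)) fun j hj => hno j ⟨hj.1, hj.2.trans_lt hy.2⟩
    have hlim : uminus k = u s + ∫ τ in s..t k, w τ • L *ᵥ u τ := by
      have hcont : ContinuousOn (fun y => ∫ τ in s..y, w τ • L *ᵥ u τ) (uIcc s (t k)) :=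
        intervalIntegral.continuousOn_primitive_interval' (hf_ii hs hsk.le (ht_le k)) left_mem_uIcc
      rw [uIcc_of_le hsk.le] at hcont
      have h1 : Tendsto (fun y => u s + ∫ τ in s..y, w τ • L *ᵥ u τ) (nhdsWithin (t k) (Iio (t k)))
          (nhds (u s + ∫ τ in s..t k, w τ • L *ᵥ u τ)) := by
        rw [← nhdsWithin_Ico_eq_nhdsLT hsk]
        exact ((hcont (t k) (right_mem_Icc.2 hsk.le)).mono Ico_subset_Icc_self).const_add _
      refine tendsto_nhds_unique (hu_left k) (h1.congr' ?_)
      filter_upwards [Ico_mem_nhdsLT hsk] with y hy using (hseg y hy).symm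
    have h := quadraticForm_le_exp_mul_of_dissipative hH_symm hL hw_nonneg hsk.le (hw_ii _ _)
      (v := Function.update u (t k) (uminus k)) (hf_ii hs hsk.le (ht_le k))
      (fun y hy => by rw [Function.update_of_ne hy.2.ne])
      (fun y hy => by
        rw [Function.update_of_ne hsk.ne]
        rcases hy.2.eq_or_lt with rfl | hlt
        · rw [Function.update_self, hlim]
        · rw [Function.update_of_ne hlt.ne, hseg y ⟨hy.1, hlt⟩])
    rwa [Function.update_self, Function.update_of_ne hsk.ne] at h
  have main (n : ℕ) : ∀ s x : ℝ, 0 ≤ s → s ≤ x → x ≤ T →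
      (Finset.univ.filter fun k => t k ∈ Ioc s x).card = n →
      u x ⬝ᵥ H *ᵥ u x ≤ Real.exp (-(2 * κ) * ∫ τ in s..x, w τ) *
        (∏ k : Fin m, (if t k ∈ Ioc s x then ρ k else 1)) * (u s ⬝ᵥ H *ᵥ u s) := by
    induction n with
    | zero =>
      intro s x hs hsx hx hcard
      have hno (k : Fin m) : t k ∉ Ioc s x := by
        simpa using Finset.filter_eq_empty_iff.1 (Finset.card_eq_zero.1 hcard) (Finset.mem_univ k)
      simp only [hno, if_false, Finset.prod_const_one, mul_one]
      exact quadraticForm_le_exp_mul_of_dissipative hH_symm hL hw_nonneg hsx (hw_ii _ _)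
        (hf_ii hs hsx hx) (fun _ _ => rfl) fun y hy => hu_int hs hy.1 (hy.2.trans hx)
          fun k hk => hno k ⟨hk.1, hk.2.trans hy.2⟩
    | succ n ih =>
      intro s x hs hsx hx hcard
      set S := Finset.univ.filter fun k => t k ∈ Ioc s x with hS
      have hne : S.Nonempty := Finset.card_pos.1 (by omega)
      set k := S.min' hne with hk
      have hkS : k ∈ S := S.min'_mem hne
      have hkI : t k ∈ Ioc s x := by simpa [hS] using hkS
      have hmin (j : Fin m) (hj : t j ∈ Ioc s x) : k ≤ j := S.min'_le j (by simpa [hS] using hj)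
      have hiff (j : Fin m) (hjk : j ≠ k) : t j ∈ Ioc s x ↔ t j ∈ Ioc (t k) x :=
        ⟨fun hj => ⟨ht_mono ((hmin j hj).lt_of_ne' hjk), hj.2⟩,
          fun hj => ⟨hkI.1.trans hj.1, hj.2⟩⟩
      have herase : (Finset.univ.filter fun j => t j ∈ Ioc (t k) x) = S.erase k := by
        ext j
        by_cases hjk : j = k
        · simp [hjk]
        · simp only [hS, Finset.mem_filter, Finset.mem_univ, true_and, Finset.mem_erase, ne_eq,
            hjk, not_false_eq_true, hiff j hjk]
      have hprod : (∏ j : Fin m, (if t j ∈ Ioc s x then ρ j else 1)) =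
          ρ k * ∏ j : Fin m, (if t j ∈ Ioc (t k) x then ρ j else 1) := by
        rw [← Finset.prod_filter, ← Finset.prod_filter, herase, Finset.mul_prod_erase S ρ hkS]
      have hle1 := hleft s k hs hkI.1 fun j hj =>
        (ht_mono.monotone (hmin j ⟨hj.1, hj.2.le.trans hkI.2⟩)).not_gt hj.2
      have hle2 := (hJ k).quadraticForm_mulVec_le (uminus k)
      rw [← hjump k] at hle2
      have hle3 := ih (t k) x (ht_pos k).le hkI.2 hx (by
        rw [herase, Finset.card_erase_of_mem hkS, hcard, Nat.add_sub_cancel])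
      have hP : 0 ≤ ∏ j : Fin m, (if t j ∈ Ioc (t k) x then ρ j else 1) :=
        Finset.prod_nonneg fun j _ => by split_ifs; exacts [(hρ j).1.le, zero_le_one]
      rw [hprod, ← intervalIntegral.integral_add_adjacent_intervals (hw_ii s (t k)) (hw_ii (t k) x),
        mul_add, Real.exp_add]
      refine hle3.trans ((mul_le_mul_of_nonneg_left (hle2.trans
        (mul_le_mul_of_nonneg_left hle1 (hρ k).1.le))
        (mul_nonneg (Real.exp_pos _).le hP)).trans_eq ?_)
      ring
  intro s x hs hsx hx
  linarith [main _ s x hs hsx hx rfl]
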